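/- arXiv:0812.0733 — 2 statements merged into one kernel-verified Lean document; each statement's English description precedes it below -/
import Mathlib

section
/- For a partition ζ of n with m_i parts equal to i, the number of noncrossing partitions of {1,...,n} whose multiset of block sizes equals ζ is n! / (m_1! m_2! ⋯ (n + 1 − ℓ(ζ))!), where ℓ(ζ) is the number of parts of ζ (Kreweras' formula). -/
/-- A set partition of `{0, …, n-1}` is noncrossing if there is no quadruple
`a < b < c < d` with `a, c` in one block and `b, d` in a different block. -/
def IsNoncrossing {n : ℕ} (P : Finpartition (Finset.univ : Finset (Fin n))) : Prop :=
  ¬ ∃ (a b c d : Fin n) (B B' : Finset (Fin n)), a < b ∧ b < c ∧ c < d ∧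
      B ∈ P.parts ∧ B' ∈ P.parts ∧ B ≠ B' ∧ a ∈ B ∧ c ∈ B ∧ b ∈ B' ∧ d ∈ B'

/-- `m_λ = ∏_i m_i(λ)!`, the product of factorials of multiplicities of parts. -/
def mfac (lam : Multiset ℕ) : ℕ := lam.toFinset.prod fun i => (lam.count i).factorial

open Finset in
/-- The functions on a finite type whose multiset of values is `s`. -/
def arrangements (α : Type*) [Fintype α] [DecidableEq α] (s : Multiset ℕ) : Finset (α → ℕ) :=
  {f ∈ Fintype.piFinset fun _ => s.toFinset | univ.val.map f = s}

section Arrangements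

open Finset

variable {α : Type*} [Fintype α]

theorem card_fiber_eq_count (f : α → ℕ) (b : ℕ) :
    Fintype.card {a // f a = b} = (univ.val.map f).count b := by
  rw [Multiset.count_map, Fintype.card_subtype]
  simp only [eq_comm, Finset.card, Finset.filter_val]

theorem exists_perm_eq_comp {f g : α → ℕ} (h : univ.val.map f = univ.val.map g) :
    ∃ σ : Equiv.Perm α, g ∘ σ = f := by
  have e (b : ℕ) : {a // f a = b} ≃ {a // g a = b} :=
    Fintype.equivOfCardEq (by rw [card_fiber_eq_count, card_fiber_eq_count, h])
  exact ⟨Equiv.ofFiberEquiv e, funext fun a => Equiv.ofFiberEquiv_map e a⟩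

variable [DecidableEq α]

theorem mem_arrangements {s : Multiset ℕ} {f : α → ℕ} :
    f ∈ arrangements α s ↔ univ.val.map f = s := by
  simp only [arrangements, mem_filter, Fintype.mem_piFinset, Multiset.mem_toFinset,
    and_iff_right_iff_imp]
  rintro rfl a
  exact Multiset.mem_map_of_mem f (mem_univ a)

theorem comp_equiv_mem_arrangements {s : Multiset ℕ} {f : α → ℕ} (hf : f ∈ arrangements α s)
    (e : α ≃ α) : f ∘ e ∈ arrangements α s := by
  rw [mem_arrangements] at hf ⊢
  rw [← Multiset.map_map, Multiset.map_univ_val_equiv, hf]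

theorem exists_mem_arrangements {s : Multiset ℕ} (hs : Multiset.card s = Fintype.card α) :
    ∃ f, f ∈ arrangements α s := by
  have e : α ≃ Fin s.toList.length := Fintype.equivFinOfCardEq (by simp [hs])
  refine ⟨s.toList.get ∘ e, mem_arrangements.2 ?_⟩
  rw [← Multiset.map_map, Multiset.map_univ_val_equiv, Fin.univ_val_map, List.ofFn_get,
    Multiset.coe_toList]

theorem card_arrangements_mul_mfac {s : Multiset ℕ} (hs : Multiset.card s = Fintype.card α) :
    #(arrangements α s) * mfac s = (Fintype.card α).factorial := by
  obtain ⟨g, hg⟩ := exists_mem_arrangements hs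
  have hstab : #{σ : Equiv.Perm α | g ∘ σ = g} = mfac s := by
    rw [← Fintype.card_subtype, DomMulAct.stabilizer_card', mfac]
    rw [mem_arrangements] at hg
    subst hg
    refine prod_congr ?_ fun b _ => by rw [card_fiber_eq_count]
    ext b
    simp
  have hfib : ∀ f ∈ arrangements α s, #{σ : Equiv.Perm α | g ∘ σ = f} = mfac s := by
    intro f hf
    rw [mem_arrangements] at hf
    obtain ⟨τ, rfl⟩ := exists_perm_eq_comp (hf.trans (mem_arrangements.1 hg).symm)
    rw [← hstab]
    refine card_equiv (Equiv.mulRight τ⁻¹) fun σ => ?_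
    simp only [mem_filter, mem_univ, true_and, Equiv.coe_mulRight, funext_iff,
      Function.comp_apply, Equiv.Perm.coe_mul]
    constructor
    · intro h a
      simpa using h (τ⁻¹ a)
    · intro h a
      simpa using h (τ a)
  rw [← Fintype.card_perm, ← card_univ, card_eq_sum_card_fiberwise
    (f := fun σ : Equiv.Perm α => g ∘ σ) (t := arrangements α s)
    (fun σ _ => comp_equiv_mem_arrangements hg σ), sum_congr rfl hfib, sum_const, smul_eq_mul]

end Arrangements

section CycleLemma

open Finset

/-- A cyclic word of length `n + 1` whose proper prefixes have sum at least their length. -/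
def IsDominating {n : ℕ} (h : ZMod (n + 1) → ℕ) : Prop :=
  ∀ i ≤ n, i ≤ ∑ j ∈ range i, h j

theorem sum_range_natCast_zmod {n : ℕ} (h : ZMod (n + 1) → ℕ) :
    ∑ j ∈ range (n + 1), h j = ∑ x, h x := by
  rw [Finset.sum_range]
  exact Finset.sum_congr rfl fun i _ => congrArg h (ZMod.natCast_zmod_val (n := n + 1) i)

/-- The cycle lemma: exactly one rotation is dominating. -/
theorem existsUnique_isDominating_rotation {n : ℕ} (h : ZMod (n + 1) → ℕ) (hsum : ∑ x, h x = n) :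
    ∃! r : ZMod (n + 1), IsDominating fun x => h (r + x) := by
  set g : ℕ → ℤ := fun k => ∑ j ∈ range k, (h j : ℤ) - k with hg
  have hper (k : ℕ) : g (n + 1 + k) = g k - 1 := by
    have h1 : ∑ j ∈ range (n + 1), (h j : ℤ) = n := by
      exact_mod_cast (sum_range_natCast_zmod h).trans hsum
    have h2 (j : ℕ) : ((n + 1 + j : ℕ) : ZMod (n + 1)) = j := by
      rw [Nat.cast_add, ZMod.natCast_self, zero_add]
    simp only [hg, sum_range_add, h1, h2]
    push_cast
    ring
  have hdom (r : ℕ) :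
      (IsDominating fun x : ZMod (n + 1) => h (r + x)) ↔ ∀ i ≤ n, g r ≤ g (r + i) := by
    refine forall₂_congr fun i _ => ?_
    simp only [hg, sum_range_add, Nat.cast_add]
    rw [← Int.ofNat_le]
    push_cast
    constructor <;> intro h <;> linarith
  obtain ⟨r, hr, hmin⟩ : ∃ r ≤ n, ∀ k ≤ n, g r ≤ g k ∧ (k < r → g r < g k) := by
    obtain ⟨m, hm, hmm⟩ := exists_min_image (range (n + 1)) g ⟨0, by simp⟩
    have hex : ∃ r, r ≤ n ∧ ∀ k ≤ n, g r ≤ g k :=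
      ⟨m, by simpa [Nat.lt_succ_iff] using hm,
        fun k hk => hmm k (by simpa [Nat.lt_succ_iff] using hk)⟩
    classical
    refine ⟨Nat.find hex, (Nat.find_spec hex).1, fun k hk => ⟨(Nat.find_spec hex).2 k hk, ?_⟩⟩
    intro hlt
    by_contra hle
    exact Nat.find_min hex hlt
      ⟨hk, fun l hl => (not_lt.1 hle).trans ((Nat.find_spec hex).2 l hl)⟩
  have hwrap {a b : ℕ} (ha : a ≤ n) (hab : b < a)
      (hd : IsDominating fun x : ZMod (n + 1) => h (a + x)) : g a < g b := by
    have := (hdom a).1 hd (n + 1 + b - a) (by omega)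
    rw [show a + (n + 1 + b - a) = n + 1 + b by omega, hper] at this
    omega
  have hle {a b : ℕ} (hb : b ≤ n) (hab : a ≤ b)
      (hd : IsDominating fun x : ZMod (n + 1) => h (a + x)) : g a ≤ g b := by
    have := (hdom a).1 hd (b - a) (by omega)
    rwa [Nat.add_sub_cancel' hab] at this
  refine ⟨(r : ZMod (n + 1)), (hdom r).2 fun i hi => ?_, fun y hy => ?_⟩
  · rcases le_or_gt (r + i) n with hn | hn
    · exact (hmin _ hn).1
    · obtain ⟨k, hk⟩ := Nat.exists_eq_add_of_le (show n + 1 ≤ r + i from hn)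
      have := (hmin k (by omega)).2 (by omega)
      rw [hk, hper]
      omega
  · have hyn : y.val ≤ n := Nat.lt_succ_iff.1 (ZMod.val_lt y)
    rw [← ZMod.natCast_zmod_val y] at hy ⊢
    rcases lt_trichotomy y.val r with hlt | heq | hlt
    · have := hle hr hlt.le hy
      have := (hmin _ hyn).2 hlt
      omega
    · rw [heq]
    · have := hwrap hyn hlt hy
      have := (hmin _ hyn).1
      omega

open Classical in
theorem card_dominating_arrangements {n : ℕ} {s : Multiset ℕ} (hs : s.sum = n) :
    (n + 1) * #{h ∈ arrangements (ZMod (n + 1)) s | IsDominating h} =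
      #(arrangements (ZMod (n + 1)) s) := by
  have key := sum_card_bipartiteAbove_eq_sum_card_bipartiteBelow
    (s := arrangements (ZMod (n + 1)) s) (t := (univ : Finset (ZMod (n + 1))))
    (fun h r => IsDominating fun x => h (r + x))
  rw [sum_congr rfl (g := fun _ => 1), sum_congr (s₂ := univ) rfl
    (g := fun _ => #{h ∈ arrangements (ZMod (n + 1)) s | IsDominating h})] at key
  · simpa [ZMod.card] using key.symm
  · intro r _
    refine card_bij' (fun h _ => h ∘ Equiv.addLeft r) (fun h _ => h ∘ Equiv.addLeft (-r))
      ?_ ?_ ?_ ?_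
    · intro h hh
      rw [mem_bipartiteBelow] at hh
      exact mem_filter.2 ⟨comp_equiv_mem_arrangements hh.1 _, hh.2⟩
    · intro h hh
      rw [mem_filter] at hh
      refine (mem_bipartiteBelow _).2 ⟨comp_equiv_mem_arrangements hh.1 _, ?_⟩
      simpa using hh.2
    · intro h _
      ext x
      simp
    · intro h _
      ext x
      simp
  · intro h hh
    rw [mem_arrangements] at hh
    obtain ⟨r, hr, hu⟩ := existsUnique_isDominating_rotation h ((congrArg Multiset.sum hh).trans hs)
    rw [card_eq_one]
    refine ⟨r, ?_⟩
    ext y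
    simp only [mem_bipartiteAbove, mem_univ, true_and, mem_singleton]
    exact ⟨hu y, fun h => h ▸ hr⟩

end CycleLemma

section BlockSizeCode

open Finset

variable {n : ℕ} {P Q : Finpartition (univ : Finset (Fin n))}

theorem card_filter_lt_eq_val (i : Fin n) : #{x | x < i} = (i : ℕ) := by
  rw [← Fin.card_Iio i]
  congr 1
  ext x
  simp

/-- The word recording the size of each block at its minimum, and `0` elsewhere. -/
def blockSizeCode (P : Finpartition (univ : Finset (Fin n))) (x : Fin n) : ℕ :=
  if ∀ y ∈ P.part x, x ≤ y then #(P.part x) else 0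

theorem blockSizeCode_ne_zero {x : Fin n} :
    blockSizeCode P x ≠ 0 ↔ ∀ y ∈ P.part x, x ≤ y := by
  have : (P.part x).Nonempty := P.part_nonempty.2 (mem_univ x)
  simp [blockSizeCode, this.ne_empty]

theorem blockSizeCode_eq_card {x : Fin n} (h : blockSizeCode P x ≠ 0) :
    blockSizeCode P x = #(P.part x) :=
  if_pos (blockSizeCode_ne_zero.1 h)

theorem part_eq_part {x y : Fin n} (h : x ∈ P.part y) : P.part x = P.part y :=
  P.part_eq_of_mem (P.part_mem.2 (mem_univ y)) h

theorem exists_blockSizeCode_ne_zero (P : Finpartition (univ : Finset (Fin n))) (y : Fin n) :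
    ∃ m ≤ y, P.part m = P.part y ∧ blockSizeCode P m ≠ 0 := by
  have hne : (P.part y).Nonempty := P.part_nonempty.2 (mem_univ y)
  have hm := part_eq_part ((P.part y).min'_mem hne)
  refine ⟨(P.part y).min' hne, min'_le _ _ (P.mem_part_self.2 (mem_univ y)), hm, ?_⟩
  rw [blockSizeCode_ne_zero, hm]
  exact fun x hx => min'_le _ _ hx

theorem map_card_parts_eq (P : Finpartition (univ : Finset (Fin n))) :
    P.parts.val.map card = (univ.val.map (blockSizeCode P)).filter (· ≠ 0) := by
  have hinj : Set.InjOn P.part ({x | blockSizeCode P x ≠ 0} : Finset (Fin n)) := by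
    intro x hx y hy hxy
    simp only [coe_filter, mem_univ, true_and, Set.mem_ofPred_eq, blockSizeCode_ne_zero] at hx hy
    apply le_antisymm
    · exact hx y (hxy ▸ P.mem_part_self.2 (mem_univ y))
    · exact hy x (hxy ▸ P.mem_part_self.2 (mem_univ x))
  have himg : P.parts = ({x | blockSizeCode P x ≠ 0} : Finset (Fin n)).image P.part := by
    ext B
    simp only [mem_image, mem_filter, mem_univ, true_and]
    constructor
    · intro hB
      obtain ⟨y, hy⟩ := P.nonempty_of_mem_parts hB
      obtain ⟨m, -, hm, hm0⟩ := exists_blockSizeCode_ne_zero P y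
      exact ⟨m, hm0, hm.trans (P.part_eq_of_mem hB hy)⟩
    · rintro ⟨m, -, rfl⟩
      exact P.part_mem.2 (mem_univ m)
  rw [himg, image_val_of_injOn hinj, Multiset.map_map, Multiset.filter_map, filter_val]
  refine Multiset.map_congr rfl fun x hx => ?_
  exact (blockSizeCode_eq_card (Multiset.mem_filter.1 hx).2).symm

theorem card_lt_le_sum_blockSizeCode (P : Finpartition (univ : Finset (Fin n))) (i : Fin n) :
    (i : ℕ) ≤ ∑ x with x < i, blockSizeCode P x := by
  have hsub : ({x | x < i} : Finset (Fin n)) ⊆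
      ({x | x < i ∧ blockSizeCode P x ≠ 0} : Finset (Fin n)).biUnion P.part := by
    intro x hx
    obtain ⟨m, hmx, hm, hm0⟩ := exists_blockSizeCode_ne_zero P x
    simp only [mem_filter, mem_univ, true_and, mem_biUnion] at hx ⊢
    exact ⟨m, ⟨hmx.trans_lt hx, hm0⟩, hm ▸ P.mem_part_self.2 (mem_univ x)⟩
  calc (i : ℕ) = #({x | x < i} : Finset (Fin n)) := (card_filter_lt_eq_val i).symm
    _ ≤ _ := (card_le_card hsub).trans card_biUnion_le
    _ = ∑ x with x < i ∧ blockSizeCode P x ≠ 0, blockSizeCode P x :=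
      sum_congr rfl fun x hx => (blockSizeCode_eq_card (mem_filter.1 hx).2.2).symm
    _ ≤ _ := sum_le_sum_of_subset fun x hx => by
      simp only [mem_filter, mem_univ, true_and] at hx ⊢
      exact hx.1

theorem IsNoncrossing.mem_part_of_le (hP : IsNoncrossing P) {m x y : Fin n}
    (hcode : blockSizeCode P = blockSizeCode Q) (hm : blockSizeCode P m ≠ 0)
    (ih : ∀ z > m, blockSizeCode P z ≠ 0 → P.part z = Q.part z)
    (hx : x ∈ P.part m) (hy : y ∈ Q.part m) (hyx : y ≤ x) : y ∈ P.part m := by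
  obtain ⟨k, hky, hk, hk0⟩ := exists_blockSizeCode_ne_zero P y
  have hyy : y ∈ P.part y := P.mem_part_self.2 (mem_univ y)
  have hmm : m ∈ P.part m := P.mem_part_self.2 (mem_univ m)
  have hkk : k ∈ P.part y := hk ▸ P.mem_part_self.2 (mem_univ k)
  have hmy : m ≤ y := blockSizeCode_ne_zero.1 (hcode ▸ hm) y hy
  rcases lt_trichotomy k m with hkm | rfl | hkm
  · by_contra hn
    have hne : P.part y ≠ P.part m := fun h => hn (h ▸ hyy)
    refine hP ⟨k, m, y, x, P.part y, P.part m, hkm, lt_of_le_of_ne hmy ?_,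
      lt_of_le_of_ne hyx ?_, P.part_mem.2 (mem_univ y), P.part_mem.2 (mem_univ m), hne,
      hkk, hyy, hmm, hx⟩
    · rintro rfl
      exact hne rfl
    · rintro rfl
      exact hn hx
  · exact hk ▸ hyy
  · exfalso
    have h1 : y ∈ Q.part k := by rw [← ih k hkm hk0, hk]; exact hyy
    have h2 : Q.part k = Q.part m := (part_eq_part h1).symm.trans (part_eq_part hy)
    have h3 : m ∈ Q.part k := h2 ▸ Q.mem_part_self.2 (mem_univ m)
    exact absurd (blockSizeCode_ne_zero.1 (hcode ▸ hk0) m h3) (not_le.2 hkm)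

theorem IsNoncrossing.part_eq_part_of_blockSizeCode_eq (hP : IsNoncrossing P)
    (hQ : IsNoncrossing Q) (hcode : blockSizeCode P = blockSizeCode Q) (m : Fin n)
    (hm : blockSizeCode P m ≠ 0) : P.part m = Q.part m := by
  induction m using WellFoundedGT.induction with
  | ind m ih =>
    have hm' : blockSizeCode Q m ≠ 0 := hcode ▸ hm
    have hcard : #(P.part m) = #(Q.part m) := by
      rw [← blockSizeCode_eq_card hm, ← blockSizeCode_eq_card hm', hcode]
    by_cases hsub : P.part m ⊆ Q.part m
    · exact eq_of_subset_of_card_le hsub hcard.ge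
    · obtain ⟨x, hx, hxQ⟩ := not_subset.1 hsub
      refine (eq_of_subset_of_card_le (fun y hy => ?_) hcard.le).symm
      rcases le_total y x with hyx | hxy
      · exact hP.mem_part_of_le hcode hm ih hx hy hyx
      · exact absurd (hQ.mem_part_of_le hcode.symm hm'
          (fun z hz hz0 => (ih z hz (hcode ▸ hz0)).symm) hy hx hxy) hxQ

theorem IsNoncrossing.parts_subset_of_blockSizeCode_eq (hP : IsNoncrossing P)
    (hQ : IsNoncrossing Q) (hcode : blockSizeCode P = blockSizeCode Q) : P.parts ⊆ Q.parts := by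
  intro B hB
  obtain ⟨y, hy⟩ := P.nonempty_of_mem_parts hB
  obtain ⟨m, -, hm, hm0⟩ := exists_blockSizeCode_ne_zero P y
  rw [← P.part_eq_of_mem hB hy, ← hm, hP.part_eq_part_of_blockSizeCode_eq hQ hcode m hm0]
  exact Q.part_mem.2 (mem_univ m)

theorem IsNoncrossing.eq_of_blockSizeCode_eq (hP : IsNoncrossing P) (hQ : IsNoncrossing Q)
    (hcode : blockSizeCode P = blockSizeCode Q) : P = Q :=
  Finpartition.ext <| (hP.parts_subset_of_blockSizeCode_eq hQ hcode).antisymm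
    (hQ.parts_subset_of_blockSizeCode_eq hP hcode.symm)

theorem exists_initial_segment {α : Type*} [LinearOrder α] (U : Finset α) {k : ℕ}
    (hk : k ≤ #U) : ∃ B ⊆ U, #B = k ∧ ∀ x ∈ B, ∀ y ∈ U, y ≤ x → y ∈ B := by
  induction k with
  | zero => exact ⟨∅, by simp⟩
  | succ k ih =>
    obtain ⟨B, hBU, hB, hlow⟩ := ih (by omega)
    have hne : (U \ B).Nonempty := by
      rw [← card_pos, card_sdiff_of_subset hBU]
      omega
    have hmem := mem_sdiff.1 ((U \ B).min'_mem hne)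
    refine ⟨insert ((U \ B).min' hne) B, insert_subset hmem.1 hBU, ?_, fun x hx y hy hyx => ?_⟩
    · rw [card_insert_of_notMem hmem.2, hB]
    · by_cases hyB : y ∈ B
      · exact mem_insert_of_mem hyB
      · rcases mem_insert.1 hx with rfl | hx
        · exact mem_insert.2 (.inl (hyx.antisymm (min'_le _ _ (mem_sdiff.2 ⟨hy, hyB⟩))))
        · exact absurd (hlow x hx y hy hyx) hyB

/-- A word dominating every strict prefix of `S` records the block sizes of a noncrossing
partition of `S`. -/
theorem exists_noncrossing_finpartition {α : Type*} [LinearOrder α] (S : Finset α) (f : α → ℕ)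
    (hdom : ∀ i ∈ S, #{x ∈ S | x < i} ≤ ∑ x ∈ S with x < i, f x) (hsum : ∑ x ∈ S, f x = #S) :
    ∃ P : Finpartition S,
      (∀ B ∈ P.parts, ∀ C ∈ P.parts, B ≠ C → ∀ a ∈ B, ∀ b ∈ C, ∀ c ∈ B, ∀ d ∈ C,
        a < b → b < c → ¬ c < d) ∧
      ∀ B ∈ P.parts, ∃ m ∈ B, (∀ x ∈ B, m ≤ x) ∧ f m = #B ∧ ∀ x ∈ B, x ≠ m → f x = 0 := by
  induction S using Finset.strongInduction with
  | H S ih =>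
    rcases S.eq_empty_or_nonempty with rfl | hS
    · exact ⟨Finpartition.empty _, by simp [Finpartition.empty], by simp [Finpartition.empty]⟩
    have hT : ({x ∈ S | f x ≠ 0} : Finset α).Nonempty := by
      by_contra hT
      rw [not_nonempty_iff_eq_empty, filter_eq_empty_iff] at hT
      have : ∑ x ∈ S, f x = 0 := sum_eq_zero fun x hx => not_not.1 (hT hx)
      have := hS.card_pos
      omega
    obtain ⟨m, hmS, hm0, hmax⟩ : ∃ m ∈ S, f m ≠ 0 ∧ ∀ x ∈ S, m < x → f x = 0 := by
      have hmem := mem_filter.1 (max'_mem _ hT)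
      refine ⟨_, hmem.1, hmem.2, fun x hx hlt => ?_⟩
      by_contra hx0
      exact absurd (le_max' _ x (mem_filter.2 ⟨hx, hx0⟩)) (not_le.2 hlt)
    have hfm : f m ≤ #{x ∈ S | m ≤ x} := by
      have h1 := card_filter_add_card_filter_not (s := S) (fun x => x < m)
      have h2 := sum_filter_add_sum_filter_not S (fun x => x < m) f
      simp only [not_lt] at h1 h2
      have h3 := single_le_sum (f := f) (s := {x ∈ S | m ≤ x}) (fun _ _ => Nat.zero_le _)
        (mem_filter.2 ⟨hmS, le_rfl⟩)
      have h4 := hdom m hmS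
      omega
    obtain ⟨B, hBU, hB, hlow⟩ := exists_initial_segment _ hfm
    have hBS : B ⊆ S := hBU.trans (filter_subset _ _)
    have hBm : ∀ x ∈ B, m ≤ x := fun x hx => (mem_filter.1 (hBU hx)).2
    have hBne : B.Nonempty := card_pos.1 (by omega)
    have hmB : m ∈ B := by
      obtain ⟨x, hx⟩ := hBne
      exact hlow x hx m (mem_filter.2 ⟨hmS, le_rfl⟩) (hBm x hx)
    have hB0 : ∀ x ∈ B, x ≠ m → f x = 0 := fun x hx hxm =>
      hmax x (hBS hx) (lt_of_le_of_ne (hBm x hx) (Ne.symm hxm))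
    have hbetween : ∀ a ∈ B, ∀ c ∈ B, ∀ b ∈ S, a ≤ b → b ≤ c → b ∈ B :=
      fun a ha c hc b hb hab hbc => hlow c hc b (mem_filter.2 ⟨hb, (hBm a ha).trans hab⟩) hbc
    have hsum' : ∑ x ∈ S \ B, f x = #(S \ B) := by
      have h1 := sum_sdiff (f := f) hBS
      rw [sum_eq_single_of_mem m hmB hB0] at h1
      rw [card_sdiff_of_subset hBS]
      omega
    obtain ⟨P, hPnc, hPf⟩ := ih (S \ B) (sdiff_ssubset hBS hBne) (fun i hi => by
      rw [mem_sdiff] at hi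
      rcases lt_or_ge i m with him | him
      · have : ({x ∈ S \ B | x < i} : Finset α) = {x ∈ S | x < i} := by
          ext x
          simp only [mem_filter, mem_sdiff]
          exact ⟨fun h => ⟨h.1.1, h.2⟩, fun h =>
            ⟨⟨h.1, fun hx => absurd (hBm x hx) (not_le.2 (h.2.trans him))⟩, h.2⟩⟩
        rw [this]
        exact hdom i hi.1
      · have him : m < i := lt_of_le_of_ne him (by rintro rfl; exact hi.2 hmB)
        rw [sum_filter_of_ne, hsum']
        · exact card_filter_le _ _
        · intro x hx hx0
          by_contra hxi
          exact hx0 (hmax x (mem_sdiff.1 hx).1 (him.trans_le (not_lt.1 hxi)))) hsum'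
    refine ⟨P.extend (b := B) (c := S) hBne.ne_empty sdiff_disjoint (sdiff_union_of_subset hBS),
      ?_, ?_⟩
    · have hout : ∀ C ∈ P.parts, ∀ x ∈ C, x ∈ S ∧ x ∉ B := fun C hC x hx =>
        mem_sdiff.1 (P.subset hC hx)
      simp only [Finpartition.extend, mem_insert]
      rintro C (rfl | hC) D (rfl | hD) hne a ha b hb c hc d hd hab hbc hcd
      · exact hne rfl
      · exact (hout D hD b hb).2 (hbetween a ha c hc b (hout D hD b hb).1 hab.le hbc.le)
      · exact (hout C hC c hc).2 (hbetween b hb d hd c (hout C hC c hc).1 hbc.le hcd.le)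
      · exact hPnc C hC D hD hne a ha b hb c hc d hd hab hbc hcd
    · simp only [Finpartition.extend, mem_insert]
      rintro C (rfl | hC)
      · exact ⟨m, hmB, hBm, hB.symm, hB0⟩
      · exact hPf C hC

theorem exists_isNoncrossing_blockSizeCode_eq (f : Fin n → ℕ)
    (hdom : ∀ i : Fin n, (i : ℕ) ≤ ∑ x with x < i, f x) (hsum : ∑ x, f x = n) :
    ∃ P : Finpartition (univ : Finset (Fin n)), IsNoncrossing P ∧ blockSizeCode P = f := by
  obtain ⟨P, hnc, hP⟩ := exists_noncrossing_finpartition (univ : Finset (Fin n)) f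
    (fun i _ => (card_filter_lt_eq_val i).trans_le (hdom i)) (by simpa using hsum)
  refine ⟨P, ?_, funext fun x => ?_⟩
  · rintro ⟨a, b, c, d, B, C, hab, hbc, hcd, hB, hC, hne, ha, hc, hb, hd⟩
    exact hnc B hB C hC hne a ha b hb c hc d hd hab hbc hcd
  · have hx : x ∈ P.part x := P.mem_part_self.2 (mem_univ x)
    obtain ⟨m, hm, hmin, hfm, h0⟩ := hP (P.part x) (P.part_mem.2 (mem_univ x))
    by_cases hxm : x = m
    · subst hxm
      rw [hfm, blockSizeCode, if_pos hmin]
    · rw [h0 x hx hxm, blockSizeCode, if_neg]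
      exact fun h => hxm ((h m hm).antisymm (hmin x hx))

end BlockSizeCode

section Kreweras

open Finset

theorem eq_add_replicate_zero_iff {s t : Multiset ℕ} (hpos : ∀ i ∈ s, 0 < i) :
    t = s + Multiset.replicate (Multiset.card t - Multiset.card s) 0 ↔
      t.filter (· ≠ 0) = s := by
  have hs : s.filter (· ≠ 0) = s := Multiset.filter_eq_self.2 fun i hi => (hpos i hi).ne'
  constructor
  · intro h
    rw [h, Multiset.filter_add, hs, Multiset.filter_eq_nil.2, add_zero]
    intro i hi
    simp [Multiset.eq_of_mem_replicate hi]
  · intro h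
    have h1 := Multiset.filter_add_not (· ≠ 0) t
    rw [h] at h1
    have h2 : t.filter (fun i => ¬ i ≠ 0) = Multiset.replicate
        (Multiset.card (t.filter (fun i => ¬ i ≠ 0))) 0 :=
      Multiset.eq_replicate_card.2 fun i hi => not_not.1 (Multiset.mem_filter.1 hi).2
    have h3 := congrArg Multiset.card h1
    rw [Multiset.card_add] at h3
    rw [← h3, Nat.add_sub_cancel_left, ← h2, h1]

theorem mfac_add_replicate_zero {s : Multiset ℕ} (hpos : ∀ i ∈ s, 0 < i) {k : ℕ} (hk : k ≠ 0) :
    mfac (s + Multiset.replicate k 0) = mfac s * k.factorial := by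
  have h0 : 0 ∉ s := fun h => (hpos 0 h).false
  have hset : (s + Multiset.replicate k 0).toFinset = insert 0 s.toFinset := by
    ext i
    simp [hk, or_comm]
  rw [mfac, hset, prod_insert (by simpa using h0), mul_comm, mfac]
  congr 1
  · refine prod_congr rfl fun i hi => ?_
    have hi0 : 0 ≠ i := by
      rintro rfl
      exact h0 (Multiset.mem_toFinset.1 hi)
    simp [Multiset.count_replicate, hi0]
  · simp [Multiset.count_eq_zero_of_notMem h0]

theorem card_le_sum_of_pos {s : Multiset ℕ} (hpos : ∀ i ∈ s, 0 < i) :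
    Multiset.card s ≤ s.sum := by
  simpa using Multiset.card_nsmul_le_sum (s := s) (a := 1) hpos

/-- The block-size words of noncrossing partitions with block sizes `s`. -/
def noncrossingCodes (n : ℕ) (s : Multiset ℕ) : Set (Fin n → ℕ) :=
  {f | (univ.val.map f).filter (· ≠ 0) = s ∧ ∀ i : Fin n, (i : ℕ) ≤ ∑ x with x < i, f x}

theorem sum_eq_of_filter_ne_zero {n : ℕ} {s : Multiset ℕ} {f : Fin n → ℕ}
    (h : (univ.val.map f).filter (· ≠ 0) = s) : ∑ x, f x = s.sum := by
  have h1 := congrArg Multiset.sum (Multiset.filter_add_not (· ≠ 0) (univ.val.map f))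
  rw [Multiset.sum_add, h, Multiset.sum_eq_zero (s := Multiset.filter (fun a => ¬ a ≠ 0) _)
    fun i hi => not_not.1 (Multiset.mem_filter.1 hi).2, add_zero] at h1
  exact h1.symm

theorem bijOn_blockSizeCode (n : ℕ) (s : Multiset ℕ) (hsum : s.sum = n) :
    Set.BijOn blockSizeCode {P : Finpartition (univ : Finset (Fin n)) |
      IsNoncrossing P ∧ P.parts.val.map card = s} (noncrossingCodes n s) := by
  refine ⟨?_, ?_, ?_⟩
  · rintro P ⟨-, hP⟩
    exact ⟨(map_card_parts_eq P).symm.trans hP, card_lt_le_sum_blockSizeCode P⟩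
  · rintro P ⟨hP, -⟩ Q ⟨hQ, -⟩ h
    exact hP.eq_of_blockSizeCode_eq hQ h
  · rintro f ⟨hf, hdom⟩
    obtain ⟨P, hP, rfl⟩ := exists_isNoncrossing_blockSizeCode_eq f hdom
      ((sum_eq_of_filter_ne_zero hf).trans hsum)
    exact ⟨P, ⟨hP, (map_card_parts_eq P).trans hf⟩, rfl⟩

theorem map_univ_zmod {n : ℕ} (h : ZMod (n + 1) → ℕ) :
    univ.val.map h = h n ::ₘ univ.val.map fun i : Fin n => h (i : ℕ) := by
  let e : Fin (n + 1) ≃ ZMod (n + 1) :=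
    { toFun := fun i => (i : ℕ)
      invFun := fun x => ⟨x.val, ZMod.val_lt x⟩
      left_inv := fun i => Fin.ext (ZMod.val_natCast_of_lt i.2)
      right_inv := fun x => ZMod.natCast_zmod_val x }
  rw [← Multiset.map_univ_val_equiv e, Multiset.map_map, Fin.univ_castSuccEmb, cons_val,
    Multiset.map_cons, map_val, Multiset.map_map]
  rfl

theorem sum_filter_lt_eq_sum_range {n : ℕ} (h : ℕ → ℕ) (i : Fin n) :
    ∑ x : Fin n with x < i, h x = ∑ j ∈ range i, h j := by
  refine sum_bij (fun x _ => (x : ℕ)) (fun x hx => ?_) (fun _ _ _ _ => Fin.ext) (fun j hj => ?_)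
    (fun _ _ => rfl)
  · exact mem_range.2 (mem_filter.1 hx).2
  · have hj := mem_range.1 hj
    exact ⟨⟨j, hj.trans i.2⟩, mem_filter.2 ⟨mem_univ _, hj⟩, rfl⟩

open Classical in
theorem bijOn_dominating_arrangements (n : ℕ) (s : Multiset ℕ) (hsum : s.sum = n)
    (hpos : ∀ i ∈ s, 0 < i) :
    Set.BijOn (fun (h : ZMod (n + 1) → ℕ) (i : Fin n) => h (i : ℕ))
      ({h ∈ arrangements (ZMod (n + 1))
        (s + Multiset.replicate (n + 1 - Multiset.card s) 0) | IsDominating h} : Finset _)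
      (noncrossingCodes n s) := by
  have hmem (h : ZMod (n + 1) → ℕ) : h ∈ ({h ∈ arrangements (ZMod (n + 1))
      (s + Multiset.replicate (n + 1 - Multiset.card s) 0) | IsDominating h} : Finset _) ↔
      h n = 0 ∧ (fun i : Fin n => h (i : ℕ)) ∈ noncrossingCodes n s := by
    have hcard : Multiset.card (univ.val.map h) = n + 1 := by simp [ZMod.card]
    have hiff := eq_add_replicate_zero_iff (t := univ.val.map h) hpos
    rw [hcard] at hiff
    have hlt (i : Fin n) := sum_filter_lt_eq_sum_range (fun j => h j) i
    simp only [mem_filter, mem_arrangements, hiff, noncrossingCodes, Set.mem_ofPred_eq, hlt]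
    constructor
    · rintro ⟨hs, hd⟩
      have htot : ∑ j ∈ range (n + 1), h j = n := by
        rw [sum_range_natCast_zmod]
        exact (congrArg Multiset.sum (hiff.2 hs)).trans (by simp [hsum])
      have h0 : h n = 0 := by
        have := hd n le_rfl
        rw [sum_range_succ] at htot
        omega
      refine ⟨h0, ?_, fun i => hd i i.2.le⟩
      rwa [map_univ_zmod, h0, Multiset.filter_cons_of_neg _ (by simp)] at hs
    · rintro ⟨h0, hs, hd⟩
      refine ⟨by rwa [map_univ_zmod, h0, Multiset.filter_cons_of_neg _ (by simp)], ?_⟩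
      intro i hi
      rcases hi.lt_or_eq with hi | rfl
      · exact hd ⟨i, hi⟩
      · rw [Finset.sum_range, sum_eq_of_filter_ne_zero hs, hsum]
  refine ⟨fun h hh => ((hmem h).1 hh).2, fun h hh k hk hhk => ?_, fun f hf => ?_⟩
  · have h0 := ((hmem h).1 hh).1
    have k0 := ((hmem k).1 hk).1
    funext x
    have hx : x.val < n + 1 := ZMod.val_lt x
    rw [← ZMod.natCast_zmod_val x]
    rcases (Nat.lt_succ_iff.1 hx).lt_or_eq with hx | hx
    · exact congrFun hhk ⟨x.val, hx⟩
    · rw [hx, h0, k0]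
  · have heq : (fun i : Fin n => (fun x : ZMod (n + 1) =>
        if hx : x.val < n then f ⟨x.val, hx⟩ else 0) (i : ℕ)) = f := by
      funext i
      simp [ZMod.val_natCast_of_lt (show (i : ℕ) < n + 1 by omega)]
    refine ⟨fun x => if hx : x.val < n then f ⟨x.val, hx⟩ else 0, (hmem _).2 ⟨?_, ?_⟩, heq⟩
    · simp [ZMod.val_natCast_of_lt (show n < n + 1 by omega)]
    · rw [heq]
      exact hf

end Kreweras

/-- Kreweras' formula: the number of noncrossing partitions of `{1, …, n}` whose multiset
of block sizes is `ζ` (a partition of `n`) is `n! / (m_1! m_2! ⋯ (n+1-ℓ(ζ))!)`. -/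
theorem stmt_5 (n : ℕ) (zeta : Multiset ℕ) (hsum : zeta.sum = n) (hpos : ∀ i ∈ zeta, 0 < i) :
    {P : Finpartition (Finset.univ : Finset (Fin n)) |
        IsNoncrossing P ∧ P.parts.val.map Finset.card = zeta}.ncard =
      n.factorial / (mfac zeta * (n + 1 - Multiset.card zeta).factorial) := by
  classical
  have hcard := hsum ▸ card_le_sum_of_pos hpos
  set s := zeta + Multiset.replicate (n + 1 - Multiset.card zeta) 0 with hs
  have hss : s.sum = n := by simp [hs, hsum]
  have hsc : Multiset.card s = Fintype.card (ZMod (n + 1)) := by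
    simp only [hs, Multiset.card_add, Multiset.card_replicate, ZMod.card]
    omega
  have hcount := card_arrangements_mul_mfac hsc
  rw [← card_dominating_arrangements hss, ZMod.card, Nat.factorial_succ, mul_assoc,
    mfac_add_replicate_zero hpos (by omega)] at hcount
  have hcodes := (bijOn_blockSizeCode n zeta hsum).ncard_eq.trans
    (bijOn_dominating_arrangements n zeta hsum hpos).ncard_eq.symm
  rw [Set.ncard_coe_finset] at hcodes
  rw [hcodes]
  refine (Nat.div_eq_of_eq_mul_left ?_ (Nat.eq_of_mul_eq_mul_left n.succ_pos hcount).symm).symm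
  exact Nat.mul_pos (Finset.prod_pos fun i _ => Nat.factorial_pos _) (Nat.factorial_pos _)
end

section
/- For a partition ζ of n with m_i parts equal to i, the number of k-divisible noncrossing partitions of {1,...,kn} whose type is ζ equals (kn)! / (m_1! m_2! ⋯ (kn + 1 − ℓ(ζ))!). -/
section

open Finset

/-- `w` is a Łukasiewicz-type word with `r` initially available slots: reading `w` from the left,
each letter uses one slot and a letter `a` creates `a` new slots; a slot is always available when
needed and no slots remain at the end. -/
def IsBallot (r : ℕ) (w : List ℕ) : Prop :=
  (∀ t < w.length, t < r + (w.take (t + 1)).sum) ∧ r + w.sum = w.length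

theorem isBallot_cons {r a : ℕ} {w : List ℕ} :
    IsBallot r (a :: w) ↔ 0 < r + a ∧ IsBallot (r + a - 1) w := by
  constructor
  · rintro ⟨h1, h2⟩
    have h0 := h1 0 (by simp)
    simp only [zero_add, List.take_succ_cons, List.take_zero, List.sum_cons, List.sum_nil,
      add_zero, List.length_cons] at h0 h2
    refine ⟨h0, fun t ht => ?_, by omega⟩
    have := h1 (t + 1) (by simpa using ht)
    simp only [List.take_succ_cons, List.sum_cons] at this
    omega
  · rintro ⟨h0, h1, h2⟩
    refine ⟨fun t ht => ?_, by simp only [List.sum_cons, List.length_cons]; omega⟩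
    cases t with
    | zero => simpa using h0
    | succ t =>
      have := h1 t (by simpa using ht)
      simp only [List.take_succ_cons, List.sum_cons]
      omega

/-- The ballot words of length `M` with `r` initial slots and nonzero letters `lam`. -/
def ballotWords : ℕ → ℕ → Multiset ℕ → Finset (List ℕ)
  | 0, r, lam => if r = 0 ∧ lam = 0 then {[]} else ∅
  | M + 1, r, lam =>
    (if 0 < r then (ballotWords M (r - 1) lam).image (List.cons 0) else ∅) ∪
      lam.toFinset.biUnion fun s => (ballotWords M (r + s - 1) (lam.erase s)).image (List.cons s)

theorem mem_ballotWords {M r : ℕ} {lam : Multiset ℕ} (h0 : 0 ∉ lam) {w : List ℕ} :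
    w ∈ ballotWords M r lam ↔
      w.length = M ∧ IsBallot r w ∧ (w : Multiset ℕ).filter (0 < ·) = lam := by
  induction M generalizing r lam w with
  | zero =>
    rw [ballotWords]
    constructor
    · intro h
      split_ifs at h with h'
      · obtain rfl := mem_singleton.1 h
        simp [IsBallot, h'.1, h'.2]
      · simp at h
    · rintro ⟨h1, h2, h3⟩
      obtain rfl := List.length_eq_zero_iff.1 h1
      have : r = 0 := by simpa [IsBallot] using h2
      rw [if_pos ⟨this, by simpa using h3.symm⟩]
      simp
  | succ M ih =>
    have herase (s : ℕ) : 0 ∉ lam.erase s := fun h => h0 (Multiset.mem_of_mem_erase h)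
    rw [ballotWords, mem_union, mem_biUnion]
    constructor
    · rintro (h | ⟨s, hs, h⟩)
      · split_ifs at h with hr
        · obtain ⟨v, hv, rfl⟩ := mem_image.1 h
          obtain ⟨h1, h2, h3⟩ := (ih h0).1 hv
          refine ⟨by simp [h1], isBallot_cons.2 ⟨hr, h2⟩, ?_⟩
          rw [← Multiset.cons_coe, Multiset.filter_cons_of_neg _ (by simp), h3]
        · simp at h
      · obtain ⟨v, hv, rfl⟩ := mem_image.1 h
        obtain ⟨h1, h2, h3⟩ := (ih (herase s)).1 hv
        rw [Multiset.mem_toFinset] at hs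
        have hs0 : 0 < s := Nat.pos_of_ne_zero fun h => h0 (h ▸ hs)
        refine ⟨by simp [h1], isBallot_cons.2 ⟨by omega, h2⟩, ?_⟩
        rw [← Multiset.cons_coe, Multiset.filter_cons_of_pos _ hs0, h3, Multiset.cons_erase hs]
    · rintro ⟨h1, h2, h3⟩
      cases w with
      | nil => simp at h1
      | cons a v =>
        obtain ⟨h4, h5⟩ := isBallot_cons.1 h2
        rw [← Multiset.cons_coe] at h3
        replace h1 : v.length = M := by simpa using h1
        obtain rfl | ha : a = 0 ∨ 0 < a := Nat.eq_zero_or_pos a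
        · left
          rw [Multiset.filter_cons_of_neg _ (by simp)] at h3
          rw [if_pos (by simpa using h4)]
          exact mem_image_of_mem _ ((ih h0).2 ⟨h1, h5, h3⟩)
        · right
          rw [Multiset.filter_cons_of_pos _ ha] at h3
          refine ⟨a, by simp [← h3], mem_image_of_mem _ ((ih (herase a)).2 ⟨h1, h5, ?_⟩)⟩
          rw [← h3, Multiset.erase_cons_head]

theorem card_ballotWords_succ {M r : ℕ} {lam : Multiset ℕ} (h0 : 0 ∉ lam) :
    #(ballotWords (M + 1) r lam) = (if 0 < r then #(ballotWords M (r - 1) lam) else 0) +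
      ∑ s ∈ lam.toFinset, #(ballotWords M (r + s - 1) (lam.erase s)) := by
  have hinj (s : ℕ) : Function.Injective (List.cons s) := List.cons_injective
  rw [ballotWords, card_union_of_disjoint, card_biUnion]
  · congr 1
    · split_ifs
      · rw [card_image_of_injective _ (hinj 0)]
      · simp
    · exact sum_congr rfl fun s _ => card_image_of_injective _ (hinj s)
  · intro s _ t _ hst
    rw [Function.onFun, disjoint_left]
    intro w hw hw'
    obtain ⟨u, -, rfl⟩ := mem_image.1 hw
    obtain ⟨v, -, hv⟩ := mem_image.1 hw'
    exact hst (List.cons.inj hv).1.symm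
  · rw [disjoint_left]
    intro w hw hw'
    split_ifs at hw with hr
    · obtain ⟨u, -, rfl⟩ := mem_image.1 hw
      obtain ⟨s, hs, hw'⟩ := mem_biUnion.1 hw'
      obtain ⟨v, -, hv⟩ := mem_image.1 hw'
      rw [(List.cons.inj hv).1] at hs
      exact h0 (Multiset.mem_toFinset.1 hs)
    · simp at hw

theorem count_mul_mfac_erase {lam : Multiset ℕ} {s : ℕ} (hs : s ∈ lam) :
    lam.count s * mfac (lam.erase s) = mfac lam := by
  have hmem : s ∈ lam.toFinset := Multiset.mem_toFinset.2 hs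
  have hsub : mfac (lam.erase s) = ∏ i ∈ lam.toFinset, ((lam.erase s).count i).factorial := by
    refine prod_subset (fun i hi => ?_) fun i _ hi => ?_
    · rw [Multiset.mem_toFinset] at hi ⊢
      exact Multiset.mem_of_mem_erase hi
    · rw [Multiset.mem_toFinset, ← Multiset.count_eq_zero] at hi
      rw [hi, Nat.factorial_zero]
  rw [hsub, mfac, ← mul_prod_erase _ _ hmem, ← mul_prod_erase _ _ hmem, ← mul_assoc,
    Multiset.count_erase_self, Nat.mul_factorial_pred (Multiset.count_pos.2 hs).ne']
  congr 1
  refine prod_congr rfl fun i hi => ?_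
  rw [Multiset.count_erase_of_ne (ne_of_mem_erase hi)]

theorem card_le_sum_of_zero_notMem {lam : Multiset ℕ} (h0 : 0 ∉ lam) :
    Multiset.card lam ≤ lam.sum := by
  have := Multiset.card_nsmul_le_sum (s := lam) (a := 1)
    fun x hx => Nat.pos_of_ne_zero fun h => h0 (h ▸ hx)
  simpa using this

theorem card_ballotWords_mul {M r : ℕ} {lam : Multiset ℕ} (h0 : 0 ∉ lam)
    (hM : lam.sum + r = M) :
    #(ballotWords M r lam) * (mfac lam * (M + 1 - Multiset.card lam).factorial) =
      (r + 1) * M.factorial := by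
  induction M generalizing r lam with
  | zero =>
    have hcard := card_le_sum_of_zero_notMem h0
    have hlam : lam = 0 := Multiset.card_eq_zero.1 (by omega)
    have hr : r = 0 := by omega
    subst hlam hr
    simp [ballotWords, mfac]
  | succ M ih =>
    have hcard := card_le_sum_of_zero_notMem h0
    set l := Multiset.card lam with hl
    have hzero : (if 0 < r then #(ballotWords M (r - 1) lam) else 0) *
        (mfac lam * (M + 1 + 1 - l).factorial) = (M + 2 - l) * r * M.factorial := by
      split_ifs with hr
      · have := ih (r := r - 1) h0 (by omega)
        rw [Nat.sub_add_cancel hr] at this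
        rw [show M + 1 + 1 - l = (M + 1 - l) + 1 by omega, Nat.factorial_succ, mul_assoc, ← this,
          ← hl]
        ring
      · simp [Nat.eq_zero_of_not_pos hr]
    have hpos (s : ℕ) (hs : s ∈ lam.toFinset) : #(ballotWords M (r + s - 1) (lam.erase s)) *
        (mfac lam * (M + 1 + 1 - l).factorial) = lam.count s * ((r + s) * M.factorial) := by
      rw [Multiset.mem_toFinset] at hs
      have hs0 : 0 < s := Nat.pos_of_ne_zero fun h => h0 (h ▸ hs)
      have hsum : s + (lam.erase s).sum = lam.sum := by
        rw [← Multiset.sum_cons, Multiset.cons_erase hs]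
      have hl0 : 0 < l := Multiset.card_pos_iff_exists_mem.2 ⟨s, hs⟩
      have := ih (r := r + s - 1) (lam := lam.erase s)
        (fun h => h0 (Multiset.mem_of_mem_erase h)) (by omega)
      rw [Multiset.card_erase_of_mem hs, ← hl, Nat.sub_add_cancel (by omega)] at this
      rw [← this, ← count_mul_mfac_erase hs, Nat.pred_eq_sub_one,
        show M + 1 - (l - 1) = M + 1 + 1 - l by omega]
      ring
    have hcount : ∑ s ∈ lam.toFinset, lam.count s = l := Multiset.toFinset_sum_count_eq lam
    have hsum : ∑ s ∈ lam.toFinset, lam.count s * s = lam.sum := by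
      simpa using (Finset.sum_multiset_count lam).symm
    rw [card_ballotWords_succ h0, add_mul, hzero, sum_mul, sum_congr rfl hpos]
    simp_rw [← mul_assoc, mul_add]
    rw [← sum_mul, sum_add_distrib, ← sum_mul, hcount, hsum, ← add_mul, Nat.factorial_succ,
      ← mul_assoc]
    congr 1
    have : (M + 2 - l) * r + l * r = (M + 2) * r := by
      rw [← add_mul, Nat.sub_add_cancel (by omega)]
    rw [← add_assoc, this]
    nlinarith [hM]

theorem card_filter_fin_eq_card_filter_range (p : ℕ → Prop) [DecidablePred p] (n : ℕ) :
    #{i : Fin n | p i} = #{i ∈ range n | p i} := by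
  rw [card_filter, card_filter, sum_range]

/-- The greedy reconstruction of a noncrossing partition from its block sizes: `a t` is the size of
the block opened at `t` (or `0` if no block is opened), and `greedyMin a t` is the minimum of the
block of `t`, the last block which is not yet complete. -/
def greedyMin (a : ℕ → ℕ) (t : ℕ) : ℕ :=
  if 0 < a t then t
  else ((range t).filter fun m => #{i : Fin t | greedyMin a i = m} < a m).sup id
termination_by t
decreasing_by all_goals exact Fin.is_lt _

/-- The number of elements before `t` lying in the block with minimum `m`. -/
def fiberBefore (f : ℕ → ℕ) (t m : ℕ) : ℕ := #{i ∈ range t | f i = m}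

theorem fiberBefore_succ (f : ℕ → ℕ) (t m : ℕ) :
    fiberBefore f (t + 1) m = fiberBefore f t m + if f t = m then 1 else 0 := by
  rw [fiberBefore, range_add_one, filter_insert, fiberBefore]
  split_ifs
  · rw [card_insert_of_notMem (by simp)]
  · rfl

theorem fiberBefore_mono (f : ℕ → ℕ) {s t : ℕ} (h : s ≤ t) (m : ℕ) :
    fiberBefore f s m ≤ fiberBefore f t m :=
  card_le_card (filter_subset_filter _ (range_mono h))

theorem sum_fiberBefore {f : ℕ → ℕ} (hf : ∀ i, f i ≤ i) (t : ℕ) :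
    ∑ m ∈ range t, fiberBefore f t m = t := by
  conv_rhs => rw [← card_range t]
  refine (card_eq_sum_card_fiberwise fun i hi => ?_).symm
  simp only [coe_range, Set.mem_Iio] at hi ⊢
  exact (hf i).trans_lt hi

theorem greedyMin_of_pos {a : ℕ → ℕ} {t : ℕ} (h : 0 < a t) : greedyMin a t = t := by
  rw [greedyMin, if_pos h]

theorem greedyMin_of_eq_zero {a : ℕ → ℕ} {t : ℕ} (h : a t = 0) :
    greedyMin a t = ((range t).filter fun m => fiberBefore (greedyMin a) t m < a m).sup id := by
  rw [greedyMin, if_neg (by omega)]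
  congr 1
  refine filter_congr fun m _ => ?_
  have : #{i : Fin t | greedyMin a i = m} = fiberBefore (greedyMin a) t m := by
    rw [fiberBefore, card_filter_fin_eq_card_filter_range fun i => greedyMin a i = m]
  rw [this]

theorem greedyMin_le (a : ℕ → ℕ) (t : ℕ) : greedyMin a t ≤ t := by
  rcases Nat.eq_zero_or_pos (a t) with h | h
  · rw [greedyMin_of_eq_zero h]
    refine Finset.sup_le fun m hm => ?_
    exact (mem_range.1 (mem_filter.1 hm).1).le
  · rw [greedyMin_of_pos h]

theorem le_greedyMin {a : ℕ → ℕ} {t m : ℕ} (hm : m ≤ t)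
    (h : fiberBefore (greedyMin a) t m < a m) : m ≤ greedyMin a t := by
  rcases Nat.eq_zero_or_pos (a t) with h0 | h0
  · have hmt : m < t := lt_of_le_of_ne hm fun e => by subst e; omega
    rw [greedyMin_of_eq_zero h0]
    exact le_sup (f := id) (mem_filter.2 ⟨mem_range.2 hmt, h⟩)
  · rwa [greedyMin_of_pos h0]

theorem fiberBefore_greedyMin_lt {a : ℕ → ℕ} {t : ℕ} (h : t < ∑ i ∈ range (t + 1), a i) :
    fiberBefore (greedyMin a) t (greedyMin a t) < a (greedyMin a t) := by
  rcases Nat.eq_zero_or_pos (a t) with h0 | h0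
  · have hne : ((range t).filter fun m => fiberBefore (greedyMin a) t m < a m).Nonempty := by
      by_contra hne
      rw [not_nonempty_iff_eq_empty, filter_eq_empty_iff] at hne
      have : ∑ m ∈ range t, a m ≤ ∑ m ∈ range t, fiberBefore (greedyMin a) t m :=
        sum_le_sum fun m hm => not_lt.1 (hne hm)
      rw [sum_fiberBefore (greedyMin_le a)] at this
      rw [sum_range_succ] at h
      omega
    obtain ⟨m, hm, hsup⟩ := exists_mem_eq_sup _ hne id
    rw [greedyMin_of_eq_zero h0, hsup]
    exact (mem_filter.1 hm).2
  · rw [greedyMin_of_pos h0]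
    have : fiberBefore (greedyMin a) t t = 0 := by
      rw [fiberBefore, card_eq_zero, filter_eq_empty_iff]
      intro i hi
      exact ((greedyMin_le a i).trans_lt (mem_range.1 hi)).ne
    omega

section

variable {a : ℕ → ℕ} {N : ℕ}

theorem fiberBefore_greedyMin_le (h : ∀ t < N, t < ∑ i ∈ range (t + 1), a i) (m : ℕ) :
    ∀ t ≤ N, fiberBefore (greedyMin a) t m ≤ a m := by
  intro t
  induction t with
  | zero => simp [fiberBefore]
  | succ t ih =>
    intro ht
    rw [fiberBefore_succ]
    split_ifs with hm
    · have := fiberBefore_greedyMin_lt (h t (by omega))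
      rw [hm] at this
      omega
    · exact ih (by omega)

theorem fiberBefore_greedyMin_eq (h : ∀ t < N, t < ∑ i ∈ range (t + 1), a i)
    (hN : ∑ i ∈ range N, a i = N) {m : ℕ} (hm : m < N) :
    fiberBefore (greedyMin a) N m = a m := by
  refine (sum_eq_sum_iff_of_le fun m _ => fiberBefore_greedyMin_le h m N le_rfl).1 ?_ m
    (mem_range.2 hm)
  rw [sum_fiberBefore (greedyMin_le a), hN]

theorem greedyMin_greedyMin (h : ∀ t < N, t < ∑ i ∈ range (t + 1), a i) {t : ℕ} (ht : t < N) :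
    greedyMin a (greedyMin a t) = greedyMin a t :=
  greedyMin_of_pos ((Nat.zero_le _).trans_lt (fiberBefore_greedyMin_lt (h t ht)))

theorem greedyMin_le_greedyMin (h : ∀ t < N, t < ∑ i ∈ range (t + 1), a i) {i j : ℕ} (hij : i < j)
    (hj : j < N) (hji : greedyMin a j ≤ i) : greedyMin a j ≤ greedyMin a i :=
  le_greedyMin hji <| (fiberBefore_mono _ hij.le _).trans_lt (fiberBefore_greedyMin_lt (h j hj))

end

/-- `f` sends each element to the minimum of its block in a noncrossing partition. -/
structure IsNoncrossingMin {N : ℕ} (f : Fin N → Fin N) : Prop where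
  le (i : Fin N) : f i ≤ i
  idem (i : Fin N) : f (f i) = f i
  nested {i j : Fin N} : i < j → f j ≤ i → f j ≤ f i

theorem IsNoncrossingMin.not_apply_lt_apply {N : ℕ} {f g : Fin N → Fin N} (hf : IsNoncrossingMin f)
    (hg : IsNoncrossingMin g) (hcard : ∀ m, #{i | f i = m} = #{i | g i = m}) {t : Fin N}
    (ih : ∀ i < t, f i = g i) : ¬ f t < g t := by
  intro hlt
  rcases (hg.le t).eq_or_lt with h | h
  · have : 0 < #{i | f i = t} := by
      rw [hcard]
      exact card_pos.2 ⟨t, by simpa using h⟩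
    obtain ⟨j, hj⟩ := card_pos.1 this
    rw [mem_filter_univ] at hj
    have := hf.idem j
    rw [hj] at this
    exact hlt.ne (this.trans h.symm)
  · by_cases hex : ∃ j, t < j ∧ f j = g t
    · obtain ⟨j, hj, hjm⟩ := hex
      exact absurd (hf.nested hj (hjm ▸ h.le)) (by rw [hjm]; exact not_le.2 hlt)
    · refine (hcard (g t)).not_lt (card_lt_card ⟨fun j hj => ?_, fun hsub => ?_⟩)
      · rw [mem_filter_univ] at hj ⊢
        rcases lt_trichotomy j t with hjt | rfl | hjt
        · rw [← ih j hjt, hj]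
        · exact absurd hj hlt.ne
        · exact absurd ⟨j, hjt, hj⟩ hex
      · have := hsub (mem_filter_univ t |>.2 rfl)
        rw [mem_filter_univ] at this
        exact hlt.ne this

theorem IsNoncrossingMin.eq_of_card {N : ℕ} {f g : Fin N → Fin N} (hf : IsNoncrossingMin f)
    (hg : IsNoncrossingMin g) (hcard : ∀ m, #{i | f i = m} = #{i | g i = m}) : f = g := by
  funext t
  induction t using WellFoundedLT.induction with
  | ind t ih =>
    exact le_antisymm (not_lt.1 (hg.not_apply_lt_apply hf (fun m => (hcard m).symm) fun i hi => (ih i hi).symm))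
      (not_lt.1 (hf.not_apply_lt_apply hg hcard ih))

theorem IsNoncrossingMin.exists_of_sum {N : ℕ} {a : ℕ → ℕ}
    (h : ∀ t < N, t < ∑ i ∈ range (t + 1), a i) (hN : ∑ i ∈ range N, a i = N) :
    ∃ f : Fin N → Fin N, IsNoncrossingMin f ∧ ∀ m, #{i | f i = m} = a m := by
  refine ⟨fun i => ⟨greedyMin a i, (greedyMin_le a i).trans_lt i.2⟩, ⟨fun i => greedyMin_le a i,
    fun i => Fin.ext (greedyMin_greedyMin h i.2),
    fun {i j} hij hji => greedyMin_le_greedyMin h hij j.2 hji⟩, fun m => ?_⟩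
  rw [← fiberBefore_greedyMin_eq h hN m.2, fiberBefore,
    ← card_filter_fin_eq_card_filter_range fun i => greedyMin a i = m]
  simp only [Fin.ext_iff]

section

variable {N : ℕ} {P : Finpartition (univ : Finset (Fin N))}

/-- The minimum of the block of `i`. -/
def blockMin (P : Finpartition (univ : Finset (Fin N))) (i : Fin N) : Fin N :=
  (P.part i).min' (P.part_nonempty.2 (mem_univ i))

theorem blockMin_mem (i : Fin N) : blockMin P i ∈ P.part i := min'_mem _ _

theorem part_eq_part_of_mem {i j : Fin N} (h : j ∈ P.part i) : P.part j = P.part i :=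
  P.part_eq_of_mem (P.part_mem.2 (mem_univ i)) h

theorem part_blockMin (i : Fin N) : P.part (blockMin P i) = P.part i :=
  part_eq_part_of_mem (blockMin_mem i)

theorem blockMin_eq_iff {i j : Fin N} : blockMin P i = blockMin P j ↔ P.part i = P.part j := by
  constructor
  · intro h
    rw [← part_blockMin i, h, part_blockMin]
  · intro h
    simp only [blockMin, h]

theorem blockMin_blockMin (i : Fin N) : blockMin P (blockMin P i) = blockMin P i :=
  blockMin_eq_iff.2 (part_blockMin i)

theorem blockMin_le_of_mem {i j : Fin N} (h : j ∈ P.part i) : blockMin P i ≤ j := min'_le _ _ h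

theorem blockMin_le (i : Fin N) : blockMin P i ≤ i :=
  blockMin_le_of_mem (P.mem_part_self.2 (mem_univ i))

theorem part_eq_filter (i : Fin N) : P.part i = univ.filter fun j => blockMin P j = blockMin P i := by
  ext j
  rw [mem_filter_univ, blockMin_eq_iff]
  exact ⟨part_eq_part_of_mem, fun h => h ▸ P.mem_part_self.2 (mem_univ j)⟩

theorem parts_eq_image_part : P.parts = univ.image P.part := by
  ext B
  rw [mem_image]
  constructor
  · intro hB
    obtain ⟨i, hi⟩ := P.nonempty_of_mem_parts hB
    exact ⟨i, mem_univ i, P.part_eq_of_mem hB hi⟩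
  · rintro ⟨i, hi, rfl⟩
    exact P.part_mem.2 hi

theorem blockMin_injective :
    Function.Injective (blockMin : Finpartition (univ : Finset (Fin N)) → Fin N → Fin N) := by
  intro P Q h
  have : P.part = Q.part := funext fun i => by rw [part_eq_filter, part_eq_filter, h]
  exact Finpartition.ext (by rw [parts_eq_image_part, parts_eq_image_part, this])

theorem isNoncrossing_iff : IsNoncrossing P ↔ IsNoncrossingMin (blockMin P) := by
  constructor
  · refine fun h => ⟨blockMin_le, blockMin_blockMin, fun {i j} hij hji => ?_⟩
    by_contra! hlt
    refine h ⟨blockMin P i, blockMin P j, i, j, P.part i, P.part j, hlt, ?_, hij,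
      P.part_mem.2 (mem_univ i), P.part_mem.2 (mem_univ j), ?_, blockMin_mem i,
      P.mem_part_self.2 (mem_univ i), blockMin_mem j, P.mem_part_self.2 (mem_univ j)⟩
    · refine lt_of_le_of_ne hji fun e => hlt.ne ?_
      rw [← e, blockMin_blockMin]
    · exact fun e => hlt.ne (blockMin_eq_iff.2 e)
  · rintro h ⟨a, b, c, d, B, B', hab, hbc, hcd, hB, hB', hne, ha, hc, hb, hd⟩
    have hBa := P.part_eq_of_mem hB ha
    have hBc := P.part_eq_of_mem hB hc
    have hBb := P.part_eq_of_mem hB' hb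
    have hBd := P.part_eq_of_mem hB' hd
    have hac : blockMin P a = blockMin P c := blockMin_eq_iff.2 (hBa.trans hBc.symm)
    have hbd : blockMin P b = blockMin P d := blockMin_eq_iff.2 (hBb.trans hBd.symm)
    have h1 : blockMin P c ≤ blockMin P b :=
      h.nested hbc (hac ▸ (blockMin_le a).trans hab.le)
    have h2 : blockMin P d ≤ blockMin P c :=
      h.nested hcd (hbd ▸ (blockMin_le b).trans hbc.le)
    have : blockMin P b = blockMin P c := le_antisymm (hbd ▸ h2) h1
    exact hne (by rw [← hBc, ← hBb, blockMin_eq_iff.1 this])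

theorem IsNoncrossingMin.exists_blockMin_eq {f : Fin N → Fin N} (hf : IsNoncrossingMin f) :
    ∃ P : Finpartition (univ : Finset (Fin N)), blockMin P = f := by
  have : DecidableRel (Setoid.ker f).r := fun i j => decEq (f i) (f j)
  refine ⟨Finpartition.ofSetoid (Setoid.ker f), funext fun i => ?_⟩
  have hmem (j : Fin N) : j ∈ (Finpartition.ofSetoid (Setoid.ker f)).part i ↔ f i = f j := by
    rw [Finpartition.mem_part_ofSetoid_iff_rel, Setoid.ker_def]
  refine le_antisymm (blockMin_le_of_mem ((hmem _).2 (hf.idem i).symm)) ?_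
  rw [(hmem _).1 (blockMin_mem i)]
  exact hf.le _

/-- The word whose `m`-th letter is the size of the block with minimum `m`, or `0` if `m` is not
the minimum of a block. -/
def blockWord (P : Finpartition (univ : Finset (Fin N))) : List ℕ :=
  List.ofFn fun m => #{i | blockMin P i = m}

theorem filter_blockWord :
    (blockWord P : Multiset ℕ).filter (0 < ·) = P.parts.val.map card := by
  have hparts : P.parts = ({m | blockMin P m = m} : Finset (Fin N)).image P.part := by
    rw [parts_eq_image_part]
    ext B
    simp only [mem_image, mem_univ, true_and, mem_filter]
    exact ⟨fun ⟨i, hi⟩ => ⟨blockMin P i, blockMin_blockMin i, by rw [part_blockMin, hi]⟩,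
      fun ⟨i, _, hi⟩ => ⟨i, hi⟩⟩
  rw [hparts, image_val_of_injOn, Multiset.map_map, blockWord, ← Fin.univ_val_map,
    Multiset.filter_map]
  · have hfilter : (univ : Finset (Fin N)).val.filter ((0 < ·) ∘ fun m => #{i | blockMin P i = m}) =
        ({m | blockMin P m = m} : Finset (Fin N)).val := by
      rw [filter_val]
      refine Multiset.filter_congr fun m _ => ?_
      rw [Function.comp_apply, card_pos]
      constructor
      · rintro ⟨i, hi⟩
        rw [mem_filter_univ] at hi
        rw [← hi, blockMin_blockMin]
      · exact fun h => ⟨m, by simpa using h⟩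
    rw [hfilter]
    refine Multiset.map_congr rfl fun m hm => ?_
    rw [Finset.mem_val, mem_filter_univ] at hm
    rw [Function.comp_apply, part_eq_filter, hm]
  · intro i hi j hj h
    simp only [coe_filter, mem_univ, true_and, Set.mem_ofPred_eq] at hi hj
    rw [← hi, ← hj]
    exact blockMin_eq_iff.2 h

theorem isBallot_blockWord : IsBallot 0 (blockWord P) := by
  constructor
  · intro t ht
    rw [blockWord, List.length_ofFn] at ht
    have hsum : ∑ m : Fin N with m.val < t + 1, #{i | blockMin P i = m} =
        #{i | (blockMin P i).val < t + 1} := by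
      rw [card_eq_sum_card_fiberwise (f := blockMin P) (t := {m | m.val < t + 1})]
      · refine sum_congr rfl fun m hm => ?_
        rw [mem_filter_univ] at hm
        congr 1
        ext i
        simp only [mem_filter, mem_univ, true_and]
        exact ⟨fun h => ⟨h ▸ hm, h⟩, fun h => h.2⟩
      · intro i hi
        simpa using hi
    have hle : #(univ.filter fun i : Fin N => i.val < t + 1) ≤ #{i | (blockMin P i).val < t + 1} :=
      card_le_card fun i hi => by
        rw [mem_filter_univ] at hi ⊢
        exact (Fin.le_def.1 (blockMin_le i)).trans_lt hi
    rw [Fin.card_filter_val_lt] at hle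
    rw [blockWord, List.sum_take_ofFn, hsum]
    omega
  · rw [blockWord, List.sum_ofFn, List.length_ofFn, zero_add,
      ← card_eq_sum_card_fiberwise fun i _ => mem_coe.2 (mem_univ (blockMin P i)), card_univ,
      Fintype.card_fin]

theorem blockWord_injOn :
    Set.InjOn blockWord {P : Finpartition (univ : Finset (Fin N)) | IsNoncrossing P} := by
  intro P hP Q hQ h
  refine blockMin_injective ((isNoncrossing_iff.1 hP).eq_of_card (isNoncrossing_iff.1 hQ) ?_)
  exact congrFun (List.ofFn_injective h)

theorem sum_take_eq_sum_range (w : List ℕ) (t : ℕ) :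
    (w.take t).sum = ∑ i ∈ range t, w.getD i 0 := by
  induction w generalizing t with
  | nil => simp
  | cons a w ih =>
    cases t with
    | zero => simp
    | succ t => rw [List.take_succ_cons, List.sum_cons, sum_range_succ', ih]; simp [add_comm]

theorem exists_blockWord_eq {w : List ℕ} (hw : IsBallot 0 w) (hN : w.length = N) :
    ∃ P : Finpartition (univ : Finset (Fin N)), IsNoncrossing P ∧ blockWord P = w := by
  subst hN
  obtain ⟨f, hf, hcard⟩ := IsNoncrossingMin.exists_of_sum (N := w.length)
    (a := fun i => w.getD i 0)
    (fun t ht => by simpa [sum_take_eq_sum_range] using hw.1 t ht)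
    (by rw [← sum_take_eq_sum_range, List.take_length, ← hw.2, zero_add])
  obtain ⟨P, rfl⟩ := hf.exists_blockMin_eq
  refine ⟨P, isNoncrossing_iff.2 hf, ?_⟩
  rw [blockWord, funext hcard]
  simp

end

/-- The Kreweras formula for the number of noncrossing partitions with given block sizes. -/
theorem ncard_isNoncrossing_mul {N : ℕ} {lam : Multiset ℕ} (h0 : 0 ∉ lam) (hsum : lam.sum = N) :
    {P : Finpartition (univ : Finset (Fin N)) |
        IsNoncrossing P ∧ P.parts.val.map card = lam}.ncard *
      (mfac lam * (N + 1 - Multiset.card lam).factorial) = N.factorial := by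
  have himage : blockWord '' {P : Finpartition (univ : Finset (Fin N)) |
      IsNoncrossing P ∧ P.parts.val.map card = lam} = ballotWords N 0 lam := by
    ext w
    rw [mem_coe, mem_ballotWords h0]
    constructor
    · rintro ⟨P, ⟨-, hP⟩, rfl⟩
      exact ⟨List.length_ofFn, isBallot_blockWord, filter_blockWord.trans hP⟩
    · rintro ⟨h1, h2, h3⟩
      obtain ⟨P, hP, rfl⟩ := exists_blockWord_eq h2 h1
      exact ⟨P, ⟨hP, filter_blockWord.symm.trans h3⟩, rfl⟩
  rw [← (blockWord_injOn.mono fun P hP => hP.1).ncard_image, himage,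
    Set.ncard_coe_finset, card_ballotWords_mul h0 hsum, zero_add, one_mul]

theorem mfac_map {f : ℕ → ℕ} (hf : Function.Injective f) (lam : Multiset ℕ) :
    mfac (lam.map f) = mfac lam := by
  rw [mfac, mfac, Multiset.toFinset_map, prod_image hf.injOn]
  simp_rw [Multiset.count_map_eq_count' f lam hf]

end

/-- The number of `k`-divisible noncrossing partitions of `{1, …, kn}` whose type
(block sizes divided by `k`) is `ζ`, a partition of `n`, is `(kn)!/(m_ζ (kn+1-ℓ(ζ))!)`. -/
theorem stmt_6 (k n : ℕ) (hk : 0 < k) (zeta : Multiset ℕ) (hsum : zeta.sum = n)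
    (hpos : ∀ i ∈ zeta, 0 < i) :
    {P : Finpartition (Finset.univ : Finset (Fin (k * n))) |
        IsNoncrossing P ∧ (∀ B ∈ P.parts, k ∣ B.card) ∧
          P.parts.val.map (fun B => B.card / k) = zeta}.ncard =
      (k * n).factorial / (mfac zeta * (k * n + 1 - Multiset.card zeta).factorial) := by
  have hinj : Function.Injective (k * ·) := fun _ _ h => Nat.eq_of_mul_eq_mul_left hk h
  have h0 : 0 ∉ zeta.map (k * ·) := by
    intro h
    obtain ⟨i, hi, h⟩ := Multiset.mem_map.1 h
    exact (Nat.mul_pos hk (hpos i hi)).ne' h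
  have hset : {P : Finpartition (Finset.univ : Finset (Fin (k * n))) |
      IsNoncrossing P ∧ (∀ B ∈ P.parts, k ∣ B.card) ∧
        P.parts.val.map (fun B => B.card / k) = zeta} =
      {P | IsNoncrossing P ∧ P.parts.val.map Finset.card = zeta.map (k * ·)} := by
    ext P
    refine and_congr_right fun _ => ⟨?_, fun h => ?_⟩
    · rintro ⟨hdvd, rfl⟩
      rw [Multiset.map_map]
      exact Multiset.map_congr rfl fun B hB => (Nat.mul_div_cancel' (hdvd B hB)).symm
    · refine ⟨fun B hB => ?_, ?_⟩
      · have : B.card ∈ zeta.map (k * ·) := h ▸ Multiset.mem_map_of_mem _ hB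
        obtain ⟨i, -, hi⟩ := Multiset.mem_map.1 this
        exact ⟨i, hi.symm⟩
      · have := congrArg (Multiset.map (· / k)) h
        simpa [Multiset.map_map, Function.comp_def, Nat.mul_div_cancel_left _ hk] using this
  have key := ncard_isNoncrossing_mul h0 (N := k * n)
    (by rw [Multiset.sum_map_mul_left, Multiset.map_id', hsum])
  rw [mfac_map hinj, Multiset.card_map] at key
  rw [hset, ← key, Nat.mul_div_cancel]
  exact Nat.mul_pos (Finset.prod_pos fun i _ => Nat.factorial_pos _) (Nat.factorial_pos _)
end
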